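/- There exists a 5-state, 58-transition RTSG solution for the sequence S = {n³ | n ≥ 1}: a cellular automaton with 5 internal states (plus outside state) and a partial transition table with 58 non-outside entries whose leftmost cell enters the special generating state exactly at times 1, 8, 27, 64, 125, … . -/

import Mathlib

/-- A cellular automaton with state type `σ`: a finite state set, a set of initial
configurations, a partial local transition function (as an `Option`-valued function),
and its (totally defined) space-time diagrams. -/
structure CA (σ : Type) where
  fin : Finite σ
  I : Set (ℤ → σ)
  δ : σ → σ → σ → Option σ
  D : (ℤ → σ) → ℕ → ℤ → σ
  D_zero : ∀ c ∈ I, D c 0 = c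
  D_succ : ∀ c ∈ I, ∀ t p, δ (D c t (p - 1)) (D c t p) (D c t (p + 1)) = some (D c (t + 1) p)

/-- The family of space-time diagrams associated to a CA. -/
def CA.Fam {σ : Type} (α : CA σ) : Set (ℕ → ℤ → σ) := { d | ∃ c ∈ α.I, d = α.D c }

/-- The local transition relation of a family of space-time diagrams. -/
def locRel {σ : Type} (F : Set (ℕ → ℤ → σ)) (x y z w : σ) : Prop :=
  ∃ d ∈ F, ∃ t : ℕ, ∃ p : ℤ,
    d t (p - 1) = x ∧ d t p = y ∧ d t (p + 1) = z ∧ d (t + 1) p = w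

/-- A family of space-time diagrams is deterministic when its local transition
relation is functional. -/
def Deterministic {σ : Type} (F : Set (ℕ → ℤ → σ)) : Prop :=
  ∀ x y z w w', locRel F x y z w → locRel F x y z w' → w = w'

/-- `β` is the cellular automaton associated to the family `F`: its initial
configurations are the time-0 slices of `F` and its local transition function is
the local transition relation of `F`. -/
def IsGamma {σ : Type} (F : Set (ℕ → ℤ → σ)) (β : CA σ) : Prop :=
  β.I = { c | ∃ d ∈ F, c = fun p => d 0 p } ∧
  ∀ x y z w, β.δ x y z = some w ↔ locRel F x y z w

/-- A local mapping: a map on initial states and a map on local configurations. -/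
structure LocalMap (σ X : Type) where
  lz : σ → X
  ls : σ → σ → σ → X

/-- The image of a space-time diagram under a local mapping. -/
def LocalMap.map {σ X : Type} (ℓ : LocalMap σ X) (d : ℕ → ℤ → σ) : ℕ → ℤ → X
  | 0, p => ℓ.lz (d 0 p)
  | t + 1, p => ℓ.ls (d t (p - 1)) (d t p) (d t (p + 1))

/-- The family of diagrams associated to a local mapping from the CA `α`. -/
def LocalMap.Phi {σ X : Type} (ℓ : LocalMap σ X) (α : CA σ) : Set (ℕ → ℤ → X) :=
  { e | ∃ c ∈ α.I, e = ℓ.map (α.D c) }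

/-- A local mapping is a local simulation from `α` to `β` when its associated family
is deterministic and `β` is the associated CA of that family. -/
def IsLocalSim {σ X : Type} (ℓ : LocalMap σ X) (α : CA σ) (β : CA X) : Prop :=
  Deterministic (ℓ.Phi α) ∧ IsGamma (ℓ.Phi α) β

/-- The RTSG initial configuration: outside state on `p ≤ 0`, `B` at `p = 1`,
quiescent `Q` on `p ≥ 2`. -/
def rtsgInit {σ : Type} (star B Q : σ) : ℤ → σ :=
  fun p => if p ≤ 0 then star else if p = 1 then B else Q

/-- An RTSG-candidate cellular automaton. -/
structure RTSGCand (σ : Type) extends CA σ where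
  star : σ
  B : σ
  Q : σ
  Sgen : σ
  init : I = {rtsgInit star B Q}
  outside : ∀ x y z w, δ x y z = some w → (w = star ↔ y = star)
  quiescent : δ Q Q Q = some Q ∧ δ star Q Q = some Q

/-- The RTSG initial configuration of an RTSG-candidate. -/
def RTSGCand.init0 {σ : Type} (α : RTSGCand σ) : ℤ → σ := rtsgInit α.star α.B α.Q

/-- The space-time diagram of an RTSG-candidate from its RTSG initial configuration. -/
def RTSGCand.diag {σ : Type} (α : RTSGCand σ) : ℕ → ℤ → σ := α.D α.init0

/-- An RTSG-candidate is an `S`-RTSG solution when the leftmost (interior) cell is in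
the special generating state exactly at the times belonging to `S`. -/
def IsSolution {σ : Type} (S : Set ℕ) (α : RTSGCand σ) : Prop :=
  ∀ t : ℕ, α.diag t 1 = α.Sgen ↔ t ∈ S

/-- RTSG-compliance of a local mapping between RTSG-candidates: conditions (0)-(3). -/
def Compliant {σ σ' : Type} (ℓ : LocalMap σ σ') (α : RTSGCand σ) (β : RTSGCand σ') : Prop :=
  (ℓ.lz α.star = β.star ∧ ℓ.lz α.B = β.B ∧ ℓ.lz α.Q = β.Q) ∧
  (∀ x y z, (α.δ x y z).isSome → (ℓ.ls x y z = β.star ↔ y = α.star)) ∧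
  (∀ y z w, α.δ α.star y z = some w → (ℓ.ls α.star y z = β.Sgen ↔ w = α.Sgen)) ∧
  (ℓ.ls α.Q α.Q α.Q = β.Q ∧ ℓ.ls α.star α.Q α.Q = β.Q)

/-- Cell states of the cube generator: the outside state `wall`, the quiescent state `q`, the
generating state `s` and three auxiliary states. -/
inductive Cell
  | wall | q | s | a | b | c
  deriving DecidableEq

namespace Cell

instance : Fintype Cell :=
  ⟨{wall, q, s, a, b, c}, fun x => by cases x <;> decide⟩

/-- The local transition table of the cube generator. The last eight entries before the
catch-all lines never occur in the space-time diagram of the generator. -/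
def rule : Cell → Cell → Cell → Option Cell
  | .wall, .q, .q => some .q
  | .wall, .q, .s => some .q
  | .wall, .q, .a => some .s
  | .wall, .q, .b => some .b
  | .wall, .s, .q => some .b
  | .wall, .s, .s => some .b
  | .wall, .b, .q => some .q
  | .wall, .b, .c => some .q
  | .wall, .c, .q => some .s
  | .q, .q, .q => some .q
  | .q, .q, .s => some .q
  | .q, .q, .a => some .a
  | .q, .q, .b => some .q
  | .q, .q, .c => some .q
  | .q, .s, .q => some .s
  | .q, .s, .s => some .q
  | .q, .s, .b => some .q
  | .q, .s, .c => some .s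
  | .q, .a, .q => some .q
  | .q, .a, .b => some .q
  | .q, .a, .c => some .q
  | .q, .b, .q => some .q
  | .q, .b, .s => some .c
  | .q, .b, .c => some .q
  | .q, .c, .q => some .q
  | .q, .c, .b => some .c
  | .q, .c, .c => some .a
  | .s, .q, .q => some .q
  | .s, .q, .a => some .b
  | .s, .q, .b => some .q
  | .s, .s, .q => some .c
  | .s, .b, .q => some .c
  | .s, .b, .s => some .a
  | .s, .c, .q => some .c
  | .s, .c, .s => some .q
  | .a, .q, .q => some .q
  | .a, .q, .s => some .q
  | .a, .b, .s => some .s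
  | .a, .c, .q => some .s
  | .b, .q, .q => some .b
  | .b, .q, .s => some .b
  | .b, .q, .b => some .s
  | .b, .s, .q => some .c
  | .b, .c, .q => some .b
  | .b, .c, .c => some .s
  | .c, .q, .q => some .s
  | .c, .q, .b => some .b
  | .c, .s, .q => some .q
  | .c, .b, .q => some .q
  | .c, .c, .q => some .b
  | .wall, .a, .q => some .q
  | .wall, .a, .s => some .q
  | .wall, .a, .a => some .q
  | .wall, .a, .b => some .q
  | .wall, .a, .c => some .q
  | .q, .a, .s => some .q
  | .q, .a, .a => some .q
  | .s, .a, .q => some .q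
  | _, .wall, _ => some .wall
  | _, _, _ => none

/-- The configuration with the listed cells on a quiescent half-line. -/
def row : List (ℤ × Cell) → ℤ → Cell
  | [], p => if p ≤ 0 then wall else q
  | (x, u) :: l, p => if p = x then u else row l p

/-- `d` is obtained from `c` by one application of the local rule everywhere. -/
def Step (c d : ℤ → Cell) : Prop :=
  ∀ p, rule (c (p - 1)) (c p) (c (p + 1)) = some (d p)

/-- `d` is obtained from `c` in `k` steps, and the leftmost cell is not generating
before the last of these configurations. -/
inductive Quiet : ℕ → (ℤ → Cell) → (ℤ → Cell) → Prop
  | refl (c : ℤ → Cell) : Quiet 0 c c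
  | cons {k : ℕ} {c d e : ℤ → Cell} (h : Step c d ∧ c 1 ≠ s) (hq : Quiet k d e) :
      Quiet (k + 1) c e

theorem Quiet.trans {j k : ℕ} {c d e : ℤ → Cell} (h₁ : Quiet j c d) (h₂ : Quiet k d e) :
    Quiet (j + k) c e := by
  induction h₁ with
  | refl => simpa using h₂
  | cons h _ ih => rw [Nat.add_right_comm]; exact .cons h (ih h₂)

theorem quiet_right {m w : ℤ} (hm : 2 ≤ m) (k : ℕ) :
    ∀ x : ℤ, m + 2 ≤ x → x + k + 1 ≤ w →
      Quiet k (row [(m, s), (x, b), (w, s)]) (row [(m, s), (x + k, b), (w, s)]) := by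
  induction k with
  | zero => intro x _ _; simpa using Quiet.refl _
  | succ k ih =>
    intro x hx hw
    push_cast at hw
    have h := ih (x + 1) (by omega) (by omega)
    rw [show x + 1 + (k : ℤ) = x + (k + 1 : ℕ) by push_cast; ring] at h
    refine .cons ?_ h
    refine ⟨fun p => ?_, by simp only [row]; split_ifs <;> first | (exfalso; omega) | decide⟩
    generalize h₁ : row _ (p - 1) = u₁, h₂ : row _ p = u₂, h₃ : row _ (p + 1) = u₃,
      h₄ : row _ p = u₄
    simp only [row] at h₁ h₂ h₃ h₄
    split_ifs at h₄ <;> split_ifs at h₂ <;> try (exfalso; omega)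
    all_goals split_ifs at h₁ <;> try (exfalso; omega)
    all_goals split_ifs at h₃ <;> first | (exfalso; omega) | (subst_vars; rfl)

theorem quiet_left {m w : ℤ} (hm : 2 ≤ m) (k : ℕ) :
    ∀ x : ℤ, m + 2 + k ≤ x → x + 4 ≤ w →
      Quiet k (row [(m, s), (x, a), (w, s)]) (row [(m, s), (x - k, a), (w, s)]) := by
  induction k with
  | zero => intro x _ _; simpa using Quiet.refl _
  | succ k ih =>
    intro x hx hw
    push_cast at hx
    have h := ih (x - 1) (by omega) (by omega)
    rw [show x - 1 - (k : ℤ) = x - (k + 1 : ℕ) by push_cast; ring] at h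
    refine .cons ?_ h
    refine ⟨fun p => ?_, by simp only [row]; split_ifs <;> first | (exfalso; omega) | decide⟩
    generalize h₁ : row _ (p - 1) = u₁, h₂ : row _ p = u₂, h₃ : row _ (p + 1) = u₃,
      h₄ : row _ p = u₄
    simp only [row] at h₁ h₂ h₃ h₄
    split_ifs at h₄ <;> split_ifs at h₂ <;> try (exfalso; omega)
    all_goals split_ifs at h₁ <;> try (exfalso; omega)
    all_goals split_ifs at h₃ <;> first | (exfalso; omega) | (subst_vars; rfl)

theorem quiet_return {w : ℤ} (k : ℕ) :
    ∀ x : ℤ, 2 + k ≤ x → x + 3 ≤ w →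
      Quiet k (row [(x, a), (w, s)]) (row [(x - k, a), (w, s)]) := by
  induction k with
  | zero => intro x _ _; simpa using Quiet.refl _
  | succ k ih =>
    intro x hx hw
    push_cast at hx
    have h := ih (x - 1) (by omega) (by omega)
    rw [show x - 1 - (k : ℤ) = x - (k + 1 : ℕ) by push_cast; ring] at h
    refine .cons ?_ h
    refine ⟨fun p => ?_, by simp only [row]; split_ifs <;> first | (exfalso; omega) | decide⟩
    generalize h₁ : row _ (p - 1) = u₁, h₂ : row _ p = u₂, h₃ : row _ (p + 1) = u₃,
      h₄ : row _ p = u₄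
    simp only [row] at h₁ h₂ h₃ h₄
    split_ifs at h₄ <;> split_ifs at h₂ <;> try (exfalso; omega)
    all_goals split_ifs at h₁ <;> try (exfalso; omega)
    all_goals split_ifs at h₃ <;> first | (exfalso; omega) | (subst_vars; rfl)

set_option maxHeartbeats 4000000 in
theorem quiet_turn_at_wall {w : ℤ} (hw : 6 ≤ w) :
    Quiet 2 (row [(2, b), (w, s)]) (row [(2, s), (4, b), (w, s)]) := by
  refine .cons (d := row [(1, b), (3, b), (w, s)]) ?_ <| .cons ?_ <| .refl _
  all_goals
    refine ⟨fun p => ?_, by simp only [row]; split_ifs <;> first | (exfalso; omega) | decide⟩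
    generalize h₁ : row _ (p - 1) = u₁, h₂ : row _ p = u₂, h₃ : row _ (p + 1) = u₃,
      h₄ : row _ p = u₄
    simp only [row] at h₁ h₂ h₃ h₄
    split_ifs at h₄ <;> split_ifs at h₂ <;> try (exfalso; omega)
    all_goals split_ifs at h₁ <;> try (exfalso; omega)
    all_goals split_ifs at h₃ <;> first | (exfalso; omega) | (subst_vars; rfl)

set_option maxHeartbeats 4000000 in
theorem quiet_turn_at_right {m w : ℤ} (hm : 2 ≤ m) (hw : m + 7 ≤ w) :
    Quiet 5 (row [(m, s), (w - 1, b), (w, s)]) (row [(m, s), (w - 4, a), (w, s)]) := by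
  refine .cons (d := row [(m, s), (w - 1, c), (w, c)]) ?_ <|
    .cons (d := row [(m, s), (w - 1, a), (w, b), (w + 1, s)]) ?_ <|
    .cons (d := row [(m, s), (w - 2, a), (w, s), (w + 1, c)]) ?_ <|
    .cons (d := row [(m, s), (w - 3, a), (w, s), (w + 1, c), (w + 2, s)]) ?_ <|
    .cons ?_ <| .refl _
  all_goals
    refine ⟨fun p => ?_, by simp only [row]; split_ifs <;> first | (exfalso; omega) | decide⟩
    generalize h₁ : row _ (p - 1) = u₁, h₂ : row _ p = u₂, h₃ : row _ (p + 1) = u₃,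
      h₄ : row _ p = u₄
    simp only [row] at h₁ h₂ h₃ h₄
    split_ifs at h₄ <;> split_ifs at h₂ <;> try (exfalso; omega)
    all_goals split_ifs at h₁ <;> try (exfalso; omega)
    all_goals split_ifs at h₃ <;> first | (exfalso; omega) | (subst_vars; rfl)

set_option maxHeartbeats 4000000 in
theorem quiet_turn_at_left {m w : ℤ} (hm : 2 ≤ m) (hw : m + 7 ≤ w) :
    Quiet 5 (row [(m, s), (m + 2, a), (w, s)])
      (row [(m + 3, s), (m + 5, b), (w, s)]) := by
  refine .cons (d := row [(m, s), (m + 1, b), (w, s)]) ?_ <|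
    .cons (d := row [(m + 1, c), (m + 2, b), (w, s)]) ?_ <|
    .cons (d := row [(m + 1, c), (m + 3, b), (w, s)]) ?_ <|
    .cons (d := row [(m + 2, b), (m + 4, b), (w, s)]) ?_ <|
    .cons ?_ <| .refl _
  all_goals
    refine ⟨fun p => ?_, by simp only [row]; split_ifs <;> first | (exfalso; omega) | decide⟩
    generalize h₁ : row _ (p - 1) = u₁, h₂ : row _ p = u₂, h₃ : row _ (p + 1) = u₃,
      h₄ : row _ p = u₄
    simp only [row] at h₁ h₂ h₃ h₄
    split_ifs at h₄ <;> split_ifs at h₂ <;> try (exfalso; omega)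
    all_goals split_ifs at h₁ <;> try (exfalso; omega)
    all_goals split_ifs at h₃ <;> first | (exfalso; omega) | (subst_vars; rfl)

set_option maxHeartbeats 4000000 in
theorem quiet_merge {m : ℤ} (hm : 2 ≤ m) :
    Quiet 13 (row [(m, s), (m + 2, b), (m + 4, s)]) (row [(m + 1, a), (m + 7, s)]) := by
  refine .cons (d := row [(m, s), (m + 3, b), (m + 4, s)]) ?_ <|
    .cons (d := row [(m, s), (m + 3, c), (m + 4, c)]) ?_ <|
    .cons (d := row [(m, s), (m + 3, a), (m + 4, b), (m + 5, s)]) ?_ <|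
    .cons (d := row [(m, s), (m + 2, a), (m + 4, s), (m + 5, c)]) ?_ <|
    .cons (d := row [(m, s), (m + 1, b), (m + 4, s), (m + 5, c), (m + 6, s)]) ?_ <|
    .cons (d := row [(m + 1, c), (m + 2, b), (m + 4, s)]) ?_ <|
    .cons (d := row [(m + 1, c), (m + 3, b), (m + 4, s)]) ?_ <|
    .cons (d := row [(m + 2, b), (m + 3, c), (m + 4, c)]) ?_ <|
    .cons (d := row [(m + 3, s), (m + 4, b), (m + 5, s)]) ?_ <|
    .cons (d := row [(m + 4, a), (m + 5, c)]) ?_ <|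
    .cons (d := row [(m + 3, a), (m + 5, s), (m + 6, s)]) ?_ <|
    .cons (d := row [(m + 2, a), (m + 6, c)]) ?_ <|
    .cons ?_ <| .refl _
  all_goals
    refine ⟨fun p => ?_, by simp only [row]; split_ifs <;> first | (exfalso; omega) | decide⟩
    generalize h₁ : row _ (p - 1) = u₁, h₂ : row _ p = u₂, h₃ : row _ (p + 1) = u₃,
      h₄ : row _ p = u₄
    simp only [row] at h₁ h₂ h₃ h₄
    split_ifs at h₄ <;> split_ifs at h₂ <;> try (exfalso; omega)
    all_goals split_ifs at h₁ <;> try (exfalso; omega)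
    all_goals split_ifs at h₃ <;> first | (exfalso; omega) | (subst_vars; rfl)

theorem quiet_round_trip {m : ℤ} (hm : 2 ≤ m) (k : ℕ) :
    Quiet (6 * k + 15) (row [(m, s), (m + 2, b), (m + 3 * (k + 1 : ℕ) + 4, s)])
      (row [(m + 3, s), (m + 3 + 2, b), (m + 3 + 3 * k + 4, s)]) := by
  have h₁ := quiet_right (w := m + 3 * (k + 1 : ℕ) + 4) hm (3 * k + 4) (m + 2) (by omega)
    (by push_cast; omega)
  have h₂ := quiet_turn_at_right (w := m + 3 * (k + 1 : ℕ) + 4) hm (by push_cast; omega)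
  have h₃ := quiet_left (w := m + 3 * (k + 1 : ℕ) + 4) hm (3 * k + 1)
    (m + 3 * (k + 1 : ℕ) + 4 - 4) (by push_cast; omega) (by omega)
  have h₄ := quiet_turn_at_left (w := m + 3 * (k + 1 : ℕ) + 4) hm (by push_cast; omega)
  have e₁ : m + 2 + (3 * k + 4 : ℕ) = m + 3 * (k + 1 : ℕ) + 4 - 1 := by push_cast; ring
  have e₂ : m + 3 * (k + 1 : ℕ) + 4 - 4 - (3 * k + 1 : ℕ) = m + 2 := by push_cast; ring
  have e₃ : m + 3 * (k + 1 : ℕ) + 4 = m + 3 + 3 * k + 4 := by push_cast; ring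
  have e₄ : m + 3 + 2 = m + 5 := by ring
  rw [e₁] at h₁
  rw [e₂] at h₃
  have h := ((h₁.trans h₂).trans h₃).trans h₄
  rw [show 3 * k + 4 + 5 + (3 * k + 1) + 5 = 6 * k + 15 by ring] at h
  rw [e₄, ← e₃]
  exact h

theorem quiet_round_trips (k : ℕ) : ∀ m : ℤ, 2 ≤ m →
    Quiet (3 * k ^ 2 + 12 * k + 13) (row [(m, s), (m + 2, b), (m + 3 * k + 4, s)])
      (row [(m + 3 * k + 1, a), (m + 3 * k + 7, s)]) := by
  induction k with
  | zero => intro m hm; simpa using quiet_merge hm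
  | succ k ih =>
    intro m hm
    have h := (quiet_round_trip hm k).trans (ih (m + 3) (by omega))
    rw [show 6 * k + 15 + (3 * k ^ 2 + 12 * k + 13) = 3 * (k + 1) ^ 2 + 12 * (k + 1) + 13 by
        ring,
      show m + 3 + 3 * (k : ℤ) + 1 = m + 3 * (k + 1 : ℕ) + 1 by push_cast; ring,
      show m + 3 + 3 * (k : ℤ) + 7 = m + 3 * (k + 1 : ℕ) + 7 by push_cast; ring] at h
    exact h

theorem quiet_stage (k : ℕ) :
    Quiet (3 * k ^ 2 + 15 * k + 17) (row [(2, b), (3 * k + 6, s)])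
      (row [(1, s), (3 * k + 9, s)]) := by
  have h₁ := quiet_turn_at_wall (w := 3 * k + 6) (by omega)
  have h₂ := quiet_round_trips k 2 le_rfl
  have h₃ := quiet_return (w := 3 * k + 9) (3 * k + 1) (3 * k + 3) (by push_cast; omega)
    (by omega)
  have h₄ : Quiet 1 (row [(2, a), (3 * k + 9, s)]) (row [(1, s), (3 * k + 9, s)]) := by
    refine .cons ?_ (.refl _)
    refine ⟨fun p => ?_, by simp only [row]; split_ifs <;> first | (exfalso; omega) | decide⟩
    generalize h₁ : row _ (p - 1) = u₁, h₂ : row _ p = u₂, h₃ : row _ (p + 1) = u₃,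
      h₄ : row _ p = u₄
    simp only [row] at h₁ h₂ h₃ h₄
    split_ifs at h₄ <;> split_ifs at h₂ <;> try (exfalso; omega)
    all_goals split_ifs at h₁ <;> try (exfalso; omega)
    all_goals split_ifs at h₃ <;> first | (exfalso; omega) | (subst_vars; rfl)
  rw [show (2 : ℤ) + 3 * k + 4 = 3 * k + 6 by ring, show (2 : ℤ) + 2 = 4 by rfl,
    show (2 : ℤ) + 3 * k + 1 = 3 * k + 3 by ring,
    show (2 : ℤ) + 3 * k + 7 = 3 * k + 9 by ring] at h₂
  rw [show (3 * k + 3 : ℤ) - (3 * k + 1 : ℕ) = 2 by push_cast; ring] at h₃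
  have h := ((h₁.trans h₂).trans h₃).trans h₄
  rw [show 2 + (3 * k ^ 2 + 12 * k + 13) + (3 * k + 1) + 1 = 3 * k ^ 2 + 15 * k + 17 by
    ring] at h
  exact h

/-- The global space-time diagram of `rule`, undefined transitions leaving cells unchanged. -/
def run (c : ℤ → Cell) : ℕ → ℤ → Cell
  | 0 => c
  | t + 1 => fun p =>
      (rule (run c t (p - 1)) (run c t p) (run c t (p + 1))).getD (run c t p)

/-- Times at which the leftmost cell has to be generating. -/
def cubes : Set ℕ := {m | ∃ n : ℕ, 1 ≤ n ∧ m = n ^ 3}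

theorem not_mem_cubes {n t : ℕ} (h₁ : n ^ 3 < t) (h₂ : t < (n + 1) ^ 3) : t ∉ cubes := by
  rintro ⟨k, -, rfl⟩
  have := lt_of_pow_lt_pow_left₀ 3 (Nat.zero_le _) h₁
  have := lt_of_pow_lt_pow_left₀ 3 (Nat.zero_le _) h₂
  omega

/-- The diagram is in configuration `c` at time `T`, having been defined and generated
correctly until then. -/
def Reaches (T : ℕ) (c : ℤ → Cell) : Prop :=
  run (row [(1, Cell.c)]) T = c ∧ ∀ t < T,
    Step (run (row [(1, Cell.c)]) t) (run (row [(1, Cell.c)]) (t + 1)) ∧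
      (run (row [(1, Cell.c)]) t 1 = s ↔ t ∈ cubes)

theorem Reaches.step {T : ℕ} {c d : ℤ → Cell} (h : Reaches T c) (hs : Step c d)
    (hc : c 1 = s ↔ T ∈ cubes) : Reaches (T + 1) d := by
  obtain ⟨rfl, h⟩ := h
  have e : run (row [(1, Cell.c)]) (T + 1) = d := by
    funext p
    simp [run, hs p]
  refine ⟨e, fun t ht => ?_⟩
  rcases Nat.lt_succ_iff_lt_or_eq.1 ht with ht | rfl
  · exact h t ht
  · exact ⟨e ▸ hs, hc⟩

theorem Reaches.quiet {k : ℕ} {c d : ℤ → Cell} (hq : Quiet k c d) :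
    ∀ {T : ℕ}, Reaches T c → (∀ t, T ≤ t → t < T + k → t ∉ cubes) → Reaches (T + k) d := by
  induction hq with
  | refl => intro T h _; exact h
  | @cons k c d e h _ ih =>
    intro T hT hc
    rw [← add_assoc, Nat.add_right_comm]
    exact ih (hT.step h.1 (iff_of_false h.2 (hc T le_rfl (by omega))))
      fun t h₁ h₂ => hc t (by omega) (by omega)

set_option maxHeartbeats 4000000 in
theorem reaches_ten : Reaches 10 (row [(2, b), (6, s)]) := by
  have h₀ : Reaches 0 (row [(1, Cell.c)]) := ⟨rfl, by simp⟩
  have h₁ : Reaches 1 (row [(1, s), (2, s)]) := by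
    refine h₀.step (fun p => ?_) (iff_of_false (by decide) ?_)
    · simp only [row]
      split_ifs <;> first | rfl | (exfalso; omega)
    · rintro ⟨n, hn, h⟩
      exact (pow_pos hn 3).ne h
  have h₂ : Reaches 2 (row [(1, b), (2, Cell.c)]) := by
    refine h₁.step (fun p => ?_) (iff_of_true (by decide) ⟨1, by norm_num⟩)
    simp only [row]
    split_ifs <;> first | rfl | (exfalso; omega)
  have h₃ : Quiet 6 (row [(1, b), (2, Cell.c)]) (row [(1, s), (5, Cell.c)]) := by
    refine .cons (d := row [(2, b), (3, s)]) ?_ <|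
      .cons (d := row [(1, b), (2, Cell.c), (3, Cell.c)]) ?_ <|
      .cons (d := row [(2, s), (3, b), (4, s)]) ?_ <|
      .cons (d := row [(3, a), (4, Cell.c)]) ?_ <|
      .cons (d := row [(2, a), (4, s), (5, s)]) ?_ <|
      .cons ?_ <| .refl _
    all_goals
      refine ⟨fun p => ?_, by decide⟩
      generalize h₁ : row _ (p - 1) = u₁, h₂ : row _ p = u₂, h₃ : row _ (p + 1) = u₃,
        h₄ : row _ p = u₄
      simp only [row] at h₁ h₂ h₃ h₄
      split_ifs at h₄ <;> split_ifs at h₂ <;> try (exfalso; omega)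
      all_goals split_ifs at h₁ <;> try (exfalso; omega)
      all_goals split_ifs at h₃ <;> first | (exfalso; omega) | (subst_vars; rfl)
  have h₈ := h₂.quiet h₃ fun t h₁ h₂ =>
    not_mem_cubes (n := 1) (by omega) (by omega)
  have h₉ : Reaches 9 (row [(1, b), (6, s)]) := by
    refine h₈.step (fun p => ?_) (iff_of_true (by decide) ⟨2, by norm_num⟩)
    simp only [row]
    split_ifs <;> first | rfl | (exfalso; omega)
  refine h₉.step (fun p => ?_) (iff_of_false (by decide)
    (not_mem_cubes (n := 2) (by omega) (by omega)))
  simp only [row]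
  split_ifs <;> first | rfl | (exfalso; omega)

theorem reaches_stage (k : ℕ) : Reaches ((k + 2) ^ 3 + 2) (row [(2, b), (3 * k + 6, s)]) := by
  induction k with
  | zero => simpa using reaches_ten
  | succ k ih =>
    have e : (k + 2) ^ 3 + 2 + (3 * k ^ 2 + 15 * k + 17) = (k + 3) ^ 3 := by ring
    have h₀ := ih.quiet (quiet_stage k) fun t h₁ h₂ =>
      not_mem_cubes (n := k + 2) (by omega) (lt_of_lt_of_eq h₂ e)
    rw [e] at h₀
    have h₁ : Reaches ((k + 3) ^ 3 + 1) (row [(1, b), (3 * k + 9, s)]) := by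
      refine h₀.step (fun p => ?_) (iff_of_true (by simp [row]) ⟨k + 3, by omega, rfl⟩)
      simp only [row]
      split_ifs <;> first | rfl | (exfalso; omega)
    have h₂ : Reaches ((k + 3) ^ 3 + 2) (row [(2, b), (3 * k + 9, s)]) := by
      refine h₁.step (fun p => ?_) (iff_of_false (by simp [row])
        (not_mem_cubes (n := k + 3) (by omega) ?_))
      · simp only [row]
        split_ifs <;> first | rfl | (exfalso; omega)
      · rw [show (k + 3 + 1) ^ 3 = (k + 3) ^ 3 + 1 + (3 * (k + 3) ^ 2 + 3 * (k + 3)) by ring]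
        omega
    rw [show (3 * (k + 1 : ℕ) + 6 : ℤ) = 3 * k + 9 by push_cast; ring]
    exact h₂

theorem run_spec (t : ℕ) :
    Step (run (row [(1, Cell.c)]) t) (run (row [(1, Cell.c)]) (t + 1)) ∧
      (run (row [(1, Cell.c)]) t 1 = s ↔ t ∈ cubes) := by
  refine (reaches_stage t).2 t ?_
  have := Nat.le_self_pow (n := 3) (by norm_num) (t + 2)
  omega

theorem rtsgInit_eq_row : rtsgInit wall Cell.c q = row [(1, Cell.c)] := by
  funext p
  simp only [rtsgInit, row]
  split_ifs <;> first | rfl | (exfalso; omega)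

/-- The cube generator as an RTSG-candidate. -/
def cubeGenerator : RTSGCand Cell where
  fin := inferInstance
  I := {rtsgInit wall Cell.c q}
  δ := rule
  D := run
  D_zero _ _ := rfl
  D_succ := by
    rintro _ rfl t p
    rw [rtsgInit_eq_row]
    exact (run_spec t).1 p
  star := wall
  B := Cell.c
  Q := q
  Sgen := s
  init := rfl
  outside := by decide
  quiescent := ⟨rfl, rfl⟩

end Cell

set_option maxRecDepth 100000 in
set_option maxHeartbeats 4000000 in
/-- there is a 5-state, 58-transition RTSG solution for the
sequence `n³` (`n ≥ 1`). -/
theorem exists_five_state_58_transition_cube_solution :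
    ∃ (σ : Type) (α : RTSGCand σ),
      Set.ncard {s : σ | s ≠ α.star} = 5 ∧
      Set.ncard {c : σ × σ × σ |
        (α.δ c.1 c.2.1 c.2.2).isSome = true ∧ c.2.1 ≠ α.star} = 58 ∧
      IsSolution {m : ℕ | ∃ n : ℕ, 1 ≤ n ∧ m = n ^ 3} α := by
  refine ⟨Cell, Cell.cubeGenerator, ?_, ?_, fun t => ?_⟩
  · change Set.ncard {x : Cell | x ≠ Cell.wall} = 5
    rw [Set.ncard_eq_toFinset_card']
    decide
  · change Set.ncard {x : Cell × Cell × Cell |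
      (Cell.rule x.1 x.2.1 x.2.2).isSome = true ∧ x.2.1 ≠ Cell.wall} = 58
    rw [Set.ncard_eq_toFinset_card']
    decide
  · change Cell.run (rtsgInit Cell.wall Cell.c Cell.q) t 1 = Cell.s ↔ t ∈ Cell.cubes
    rw [Cell.rtsgInit_eq_row]
    exact (Cell.run_spec t).2
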